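/- Let S be a 0-left cancellative semigroup with zero admitting least common multiples. Let Λ be a finite subset of ~S with Λ ∩ S ≠ ∅, let u ∈ Λ, and suppose X is a constructible subset of S' with X ⊆ uF_Λ. Then there exist x ∈ ~S and a finite subset Δ ⊆ ~S with Λx ⊆ Δ such that X = uxF_Δ. -/

import Mathlib

/-- A semigroup with zero is `0`-left cancellative if `s*t = s*r ≠ 0` implies `t = r`. -/
def ZeroLeftCancellative (S : Type*) [SemigroupWithZero S] : Prop :=
  ∀ s t r : S, s * t = s * r → s * t ≠ 0 → t = r

/-- `s` divides `t` when `t ∈ {s} ∪ sS`. -/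
def Divides {S : Type*} [Mul S] (s t : S) : Prop := t = s ∨ ∃ u, s * u = t

/-- `r` is a least common multiple of `s` and `t` when `sS ∩ tS = rS` and both `s` and `t`
divide `r`. -/
def IsLCM {S : Type*} [Mul S] (s t r : S) : Prop :=
  ({x | ∃ u, x = s * u} ∩ {x | ∃ u, x = t * u} = {x | ∃ u, x = r * u}) ∧
    Divides s r ∧ Divides t r

/-- The regular representation: `theta s` is the graph of the partial bijection
`θ_s : F_s → E_s`, `x ↦ s*x`, of `S' = S \ {0}`. -/
def theta {S : Type*} [SemigroupWithZero S] (s : S) : S → S → Prop :=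
  fun x y => x ≠ 0 ∧ s * x ≠ 0 ∧ y = s * x

/-- The identity partial bijection on a subset `X`, viewed as a relation. -/
def idOn {α : Type*} (X : Set α) : α → α → Prop := fun x y => x = y ∧ x ∈ X

/-- The inverse subsemigroup of the symmetric inverse semigroup generated by the
partial bijections `π s`, where relations model partial bijections by their graphs:
`Relation.Comp r₁ r₂` applies `r₁` first, and `flip r` is the inverse of `r`. -/
inductive InHull {S α : Type*} (π : S → α → α → Prop) : (α → α → Prop) → Prop
  | base (s : S) : InHull π (π s)
  | inv {r : α → α → Prop} : InHull π r → InHull π (flip r)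
  | comp {r₁ r₂ : α → α → Prop} : InHull π r₁ → InHull π r₂ →
      InHull π (Relation.Comp r₁ r₂)

/-- `X ⊆ S'` is constructible when `id_X` belongs to the idempotent semilattice of the
inverse hull `H(S)` of the regular representation. -/
def Constructible (S : Type*) [SemigroupWithZero S] (X : Set S) : Prop :=
  InHull (theta (S := S)) (idOn X)

/-- Multiplication in `~S = S ∪ {1}`, modelled as `Option S` with `none` the adjoined
unit `1`. -/
def tmul {S : Type*} [Mul S] : Option S → Option S → Option S
  | none, y => y
  | some s, none => some s
  | some s, some t => some (s * t)

/-- The regular representation extended to `~S`, with `θ_1` the identity map of `S'`. -/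
def etheta {S : Type*} [SemigroupWithZero S] : Option S → S → S → Prop
  | none => fun x y => x = y ∧ x ≠ 0
  | some s => theta s

/-- `F_Λ = ⋂_{w ∈ Λ} F_w`, the intersection of the domains of the `θ_w`, `w ∈ Λ ⊆ ~S`. -/
def FLam {S : Type*} [SemigroupWithZero S] (Λ : Set (Option S)) : Set S :=
  {x | ∀ w ∈ Λ, ∃ y, etheta w x y}

/-- The action of an element `u` of `~S` on `S`. -/
def tapp {S : Type*} [Mul S] : Option S → S → S
  | none, x => x
  | some s, x => s * x

/-- For `u ∈ ~S` and `Y ⊆ S'`, `actSet u Y` is `uY ∖ {0}`, that is,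
the image `θ_u(Y ∩ F_u)` of `Y` under the partial bijection `θ_u`. -/
def actSet {S : Type*} [SemigroupWithZero S] (u : Option S) (Y : Set S) : Set S :=
  {z | z ≠ 0 ∧ ∃ y ∈ Y, y ≠ 0 ∧ z = tapp u y}

section TildeAction

variable {S : Type*} [SemigroupWithZero S]

theorem tapp_tmul (a b : Option S) (x : S) : tapp (tmul a b) x = tapp a (tapp b x) := by
  cases a <;> cases b <;> simp [tmul, tapp, mul_assoc]

theorem tapp_zero (a : Option S) : tapp a (0 : S) = 0 := by
  cases a <;> simp [tapp]

theorem ne_zero_of_tapp_ne_zero {a : Option S} {x : S} (h : tapp a x ≠ 0) : x ≠ 0 := by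
  rintro rfl
  exact h (tapp_zero a)

theorem exists_etheta_iff {w : Option S} {x : S} : (∃ y, etheta w x y) ↔ tapp w x ≠ 0 := by
  cases w with
  | none => simp [etheta, tapp]
  | some s =>
    simp only [etheta, theta, tapp]
    exact ⟨fun ⟨_, _, h, _⟩ => h, fun h => ⟨_, right_ne_zero_of_mul h, h, rfl⟩⟩

theorem mem_FLam_iff {Λ : Set (Option S)} {x : S} :
    x ∈ FLam Λ ↔ ∀ w ∈ Λ, tapp w x ≠ 0 := by
  simp only [FLam, Set.mem_ofPred_eq, exists_etheta_iff]

theorem ZeroLeftCancellative.tapp_inj (hlc : ZeroLeftCancellative S) {a : Option S} {x y : S}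
    (h : tapp a x = tapp a y) (h0 : tapp a x ≠ 0) : x = y := by
  cases a with
  | none => exact h
  | some s => exact hlc s x y h h0

theorem Divides.exists_tmul_eq {s r : S} (h : Divides s r) :
    ∃ p : Option S, tmul (some s) p = some r := by
  rcases h with rfl | ⟨u, rfl⟩
  · exact ⟨none, rfl⟩
  · exact ⟨some u, rfl⟩

/-- Least common multiples in `~S`, through the factorizations they induce: every nonzero
common value of `a` and `b` factors through a single common multiple `ap = bq`. -/
theorem exists_tmul_eq_tmul_and_factor (hlc : ZeroLeftCancellative S)
    (hlcm : ∀ s t : S, ∃ r : S, IsLCM s t r) (a b : Option S) :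
    ∃ p q : Option S, tmul a p = tmul b q ∧
      ∀ y z : S, tapp a y = tapp b z → tapp a y ≠ 0 → ∃ t, y = tapp p t ∧ z = tapp q t := by
  cases a with
  | none => exact ⟨b, none, by cases b <;> rfl, fun y z h _ => ⟨z, h, rfl⟩⟩
  | some s =>
    cases b with
    | none => exact ⟨none, some s, rfl, fun y z h _ => ⟨y, rfl, h.symm⟩⟩
    | some s' =>
      obtain ⟨r, hr, hs, hs'⟩ := hlcm s s'
      obtain ⟨p, hp⟩ := hs.exists_tmul_eq
      obtain ⟨q, hq⟩ := hs'.exists_tmul_eq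
      refine ⟨p, q, hp.trans hq.symm, fun y z h h0 => ?_⟩
      obtain ⟨t, ht⟩ : s * y ∈ {x | ∃ u, x = r * u} := hr ▸ ⟨⟨y, rfl⟩, ⟨z, h⟩⟩
      have hpt : tapp (some s) y = tapp (some s) (tapp p t) := by
        rw [← tapp_tmul, hp]
        exact ht
      have hqt : tapp (some s') z = tapp (some s') (tapp q t) := by
        rw [← tapp_tmul, hq, ← h]
        exact ht
      exact ⟨t, hlc.tapp_inj hpt h0, hlc.tapp_inj hqt (h ▸ h0)⟩

theorem mem_FLam_union_image_iff [DecidableEq (Option S)] {Γ Γ' : Finset (Option S)}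
    {p q : Option S} {t : S} :
    t ∈ FLam (↑(Γ.image (tmul · p) ∪ Γ'.image (tmul · q)) : Set (Option S)) ↔
      tapp p t ∈ FLam (↑Γ : Set (Option S)) ∧ tapp q t ∈ FLam (↑Γ' : Set (Option S)) := by
  simp only [mem_FLam_iff, Finset.mem_coe, Finset.mem_union, Finset.mem_image, or_imp,
    forall_and, forall_exists_index, and_imp, forall_apply_eq_imp_iff₂, tapp_tmul]

/-- Every element of the inverse hull has the form `θ_u id_{F_Γ} θ_v⁻¹` with `u, v ∈ Γ`. -/
theorem InHull.exists_normal_form (hlc : ZeroLeftCancellative S)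
    (hlcm : ∀ s t : S, ∃ r : S, IsLCM s t r) {ρ : S → S → Prop}
    (h : InHull (theta (S := S)) ρ) :
    ∃ (v u : Option S) (Γ : Finset (Option S)), v ∈ Γ ∧ u ∈ Γ ∧
      ∀ x y, ρ x y ↔ ∃ z ∈ FLam (↑Γ : Set (Option S)), x = tapp v z ∧ y = tapp u z := by
  classical
  induction h with
  | base s =>
    refine ⟨none, some s, {none, some s}, by simp, by simp, fun x y => ?_⟩
    simp [mem_FLam_iff, theta, tapp, and_assoc]
  | inv _ ih =>
    obtain ⟨v, u, Γ, hv, hu, h⟩ := ih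
    refine ⟨u, v, Γ, hu, hv, fun x y => ?_⟩
    simp only [flip, h, and_comm]
  | comp _ _ ih₁ ih₂ =>
    obtain ⟨v, u, Γ, hv, hu, h₁⟩ := ih₁
    obtain ⟨v', u', Γ', hv', hu', h₂⟩ := ih₂
    obtain ⟨p, q, hpq, hfac⟩ := exists_tmul_eq_tmul_and_factor hlc hlcm u v'
    refine ⟨tmul v p, tmul u' q, Γ.image (tmul · p) ∪ Γ'.image (tmul · q),
      Finset.mem_union_left _ (Finset.mem_image_of_mem _ hv),
      Finset.mem_union_right _ (Finset.mem_image_of_mem _ hu'), fun x y => ?_⟩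
    simp only [Relation.Comp, h₁, h₂, mem_FLam_union_image_iff, tapp_tmul]
    constructor
    · rintro ⟨_, ⟨z, hz, rfl, rfl⟩, z', hz', hzz', rfl⟩
      obtain ⟨t, rfl, rfl⟩ := hfac z z' hzz' (mem_FLam_iff.1 hz u hu)
      exact ⟨t, ⟨hz, hz'⟩, rfl, rfl⟩
    · rintro ⟨t, ⟨hz, hz'⟩, rfl, rfl⟩
      exact ⟨_, ⟨_, hz, rfl, rfl⟩, _, hz', by rw [← tapp_tmul, hpq, tapp_tmul], rfl⟩

theorem mem_actSet_FLam_iff {Γ : Finset (Option S)} {v : Option S} (hv : v ∈ Γ) {x : S} :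
    x ∈ actSet v (FLam (↑Γ : Set (Option S))) ↔
      ∃ z ∈ FLam (↑Γ : Set (Option S)), x = tapp v z := by
  constructor
  · rintro ⟨_, z, hz, _, rfl⟩
    exact ⟨z, hz, rfl⟩
  · rintro ⟨z, hz, rfl⟩
    have h0 := mem_FLam_iff.1 hz v hv
    exact ⟨h0, z, hz, ne_zero_of_tapp_ne_zero h0, rfl⟩

theorem Constructible.exists_eq_actSet (hlc : ZeroLeftCancellative S)
    (hlcm : ∀ s t : S, ∃ r : S, IsLCM s t r) {X : Set S} (hX : Constructible S X) :
    ∃ (v : Option S) (Γ : Finset (Option S)), v ∈ Γ ∧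
      X = actSet v (FLam (↑Γ : Set (Option S))) := by
  obtain ⟨v, u, Γ, hv, -, h⟩ := InHull.exists_normal_form hlc hlcm hX
  refine ⟨v, Γ, hv, Set.ext fun x => ?_⟩
  rw [mem_actSet_FLam_iff hv]
  constructor
  · intro hx
    obtain ⟨z, hz, hxz, -⟩ := (h x x).1 ⟨rfl, hx⟩
    exact ⟨z, hz, hxz⟩
  · rintro ⟨z, hz, rfl⟩
    exact ((h _ _).2 ⟨z, hz, rfl, rfl⟩).2

end TildeAction

/-- If `X` is a constructible set contained in `uF_Λ`, then `X = uxF_Δ` for some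
`x ∈ ~S` and some finite `Δ ⊆ ~S` containing `Λx`. -/
theorem inverseHull.formOfSubsets {S : Type*} [SemigroupWithZero S]
    (hlc : ZeroLeftCancellative S)
    (hlcm : ∀ s t : S, ∃ r : S, IsLCM s t r)
    (Λ : Finset (Option S)) (hΛS : ∃ s : S, some s ∈ Λ)
    (u : Option S) (hu : u ∈ Λ)
    (X : Set S) (hX : Constructible S X)
    (hsub : X ⊆ actSet u (FLam (↑Λ : Set (Option S)))) :
    ∃ (x : Option S) (Δ : Finset (Option S)),
      (∀ w ∈ Λ, tmul w x ∈ Δ) ∧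
      X = actSet (tmul u x) (FLam (↑Δ : Set (Option S))) := by
  classical
  obtain ⟨v, Γ, hv, rfl⟩ := hX.exists_eq_actSet hlc hlcm
  obtain ⟨p, q, hpq, hfac⟩ := exists_tmul_eq_tmul_and_factor hlc hlcm v u
  have hΛq : ∀ w ∈ Λ, tmul w q ∈ Γ.image (tmul · p) ∪ Λ.image (tmul · q) := fun w hw =>
    Finset.mem_union_right _ (Finset.mem_image_of_mem _ hw)
  refine ⟨q, Γ.image (tmul · p) ∪ Λ.image (tmul · q), hΛq, Set.ext fun x => ?_⟩
  rw [mem_actSet_FLam_iff (hΛq u hu)]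
  simp only [mem_FLam_union_image_iff]
  constructor
  · intro hx
    obtain ⟨f, hf, hxf⟩ := (mem_actSet_FLam_iff hu).1 (hsub hx)
    obtain ⟨y, hy, rfl⟩ := (mem_actSet_FLam_iff hv).1 hx
    obtain ⟨t, rfl, rfl⟩ := hfac y f hxf hx.1
    exact ⟨t, ⟨hy, hf⟩, by rw [hxf, tapp_tmul]⟩
  · rintro ⟨t, ⟨hy, -⟩, rfl⟩
    exact (mem_actSet_FLam_iff hv).2 ⟨_, hy, by rw [← hpq, tapp_tmul]⟩
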